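/- arXiv:1609.07528 — 4 statements merged into one kernel-verified Lean document; each statement's English description precedes it below -/
import Mathlib

section
/- Let (Ω, μ) be a measure space and let f, g : Ω → ℝ≥0∞ be measurable. Then the map λ ↦ ∫ f^λ · g^(1−λ) dμ is log-convex on [0,1]: for all λ₁, λ₂ ∈ [0,1] and t ∈ [0,1], ∫ f^(t·λ₁+(1−t)·λ₂) · g^(1−t·λ₁−(1−t)·λ₂) dμ ≤ (∫ f^(λ₁) · g^(1−λ₁) dμ)^t · (∫ f^(λ₂) · g^(1−λ₂) dμ)^(1−t). -/
open MeasureTheory ENNReal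

theorem lintegral_rpow_mul_rpow_logConvex
    {Ω : Type*} [MeasurableSpace Ω] (μ : Measure Ω)
    (f g : Ω → ℝ≥0∞) (hf : Measurable f) (hg : Measurable g)
    (lam₁ lam₂ t : ℝ)
    (h₁ : lam₁ ∈ Set.Icc (0 : ℝ) 1) (h₂ : lam₂ ∈ Set.Icc (0 : ℝ) 1)
    (ht : t ∈ Set.Icc (0 : ℝ) 1) :
    ∫⁻ ω, (f ω) ^ (t * lam₁ + (1 - t) * lam₂) * (g ω) ^ (1 - (t * lam₁ + (1 - t) * lam₂)) ∂μ
      ≤ (∫⁻ ω, (f ω) ^ lam₁ * (g ω) ^ (1 - lam₁) ∂μ) ^ t *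
        (∫⁻ ω, (f ω) ^ lam₂ * (g ω) ^ (1 - lam₂) ∂μ) ^ (1 - t) := by
  obtain ⟨h₁0, h₁1⟩ := h₁
  obtain ⟨h₂0, h₂1⟩ := h₂
  obtain ⟨ht0, ht1⟩ := ht
  have ht' : 0 ≤ 1 - t := sub_nonneg.2 ht1
  have h₁' : 0 ≤ 1 - lam₁ := sub_nonneg.2 h₁1
  have h₂' : 0 ≤ 1 - lam₂ := sub_nonneg.2 h₂1
  have key (ω : Ω) :
      (f ω) ^ (t * lam₁ + (1 - t) * lam₂) * (g ω) ^ (1 - (t * lam₁ + (1 - t) * lam₂)) =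
        ((f ω) ^ lam₁ * (g ω) ^ (1 - lam₁)) ^ t *
          ((f ω) ^ lam₂ * (g ω) ^ (1 - lam₂)) ^ (1 - t) := by
    rw [show 1 - (t * lam₁ + (1 - t) * lam₂) = (1 - lam₁) * t + (1 - lam₂) * (1 - t) by ring,
      mul_comm t, mul_comm (1 - t) lam₂,
      rpow_add_of_nonneg _ _ (mul_nonneg h₁0 ht0) (mul_nonneg h₂0 ht'),
      rpow_add_of_nonneg _ _ (mul_nonneg h₁' ht0) (mul_nonneg h₂' ht'),
      mul_rpow_of_nonneg _ _ ht0, mul_rpow_of_nonneg _ _ ht']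
    simp only [rpow_mul]
    exact mul_mul_mul_comm _ _ _ _
  simp_rw [key]
  exact lintegral_mul_norm_pow_le (by fun_prop) (by fun_prop) ht0 ht' (by ring)
end

section
/- Let A, B ∈ ℝ with A ≠ B, let σ > 0, and let (a₁, a₂) ∈ ℝ² with (a₁, a₂) ≠ (0,0). Set s² = (a₁² + a₂²)σ². Then the Chernoff information between the mixed-observation distributions, max_{0≤λ≤1} (−log ∫_ℝ φ_{a₁A+a₂B, s²}(y)^λ · φ_{a₁B+a₂A, s²}(y)^(1−λ) dy), equals (a₁−a₂)²(A−B)² / (8(a₁²+a₂²)σ²); moreover this value is at most 2·(A−B)²/(8σ²) = (A−B)²/(4σ²), with equality if and only if a₁ = −a₂. In particular, the optimal linear mixing a₁ = −a₂ doubles the Chernoff information (A−B)²/(8σ²) obtained from a separate observation of a single variable. -/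
open MeasureTheory Real

/-- The Gaussian probability density with mean `μ` and variance `σ²`. -/
noncomputable def gaussianPdf (μ σ : ℝ) (y : ℝ) : ℝ :=
  (Real.sqrt (2 * Real.pi * σ ^ 2))⁻¹ * Real.exp (-(y - μ) ^ 2 / (2 * σ ^ 2))

/-- The Gaussian density integrates to one. -/
theorem integral_gaussianPdf (μ : ℝ) {s : ℝ} (hs : 0 < s) : ∫ y, gaussianPdf μ s y = 1 := by
  have hv : (⟨s ^ 2, sq_nonneg s⟩ : NNReal) ≠ 0 := by
    intro h
    exact (pow_pos hs 2).ne' (congrArg NNReal.toReal h)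
  exact ProbabilityTheory.integral_gaussianPDFReal_eq_one μ hv

/-- A geometric mixture of two Gaussian densities of equal variance is a multiple of the Gaussian
density centred at the mixture of the means. -/
theorem gaussianPdf_rpow_mul_rpow (μ ν : ℝ) {s : ℝ} (hs : 0 < s) (l y : ℝ) :
    gaussianPdf μ s y ^ l * gaussianPdf ν s y ^ (1 - l) =
      Real.exp (-(l * (1 - l) * (μ - ν) ^ 2 / (2 * s ^ 2))) *
        gaussianPdf (l * μ + (1 - l) * ν) s y := by
  unfold gaussianPdf
  have hc : 0 < (Real.sqrt (2 * Real.pi * s ^ 2))⁻¹ := by positivity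
  generalize (Real.sqrt (2 * Real.pi * s ^ 2))⁻¹ = c at hc ⊢
  rw [Real.mul_rpow hc.le (Real.exp_pos _).le, Real.mul_rpow hc.le (Real.exp_pos _).le,
    ← Real.exp_mul, ← Real.exp_mul, mul_mul_mul_comm, ← Real.rpow_add hc, ← Real.exp_add,
    mul_left_comm, ← Real.exp_add, add_sub_cancel, Real.rpow_one]
  congr 2
  field_simp
  ring

/-- The exponent of the Chernoff integral of two Gaussian densities of equal variance. -/
theorem neg_log_integral_gaussianPdf_rpow (μ ν : ℝ) {s : ℝ} (hs : 0 < s) (l : ℝ) :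
    -Real.log (∫ y, gaussianPdf μ s y ^ l * gaussianPdf ν s y ^ (1 - l)) =
      l * (1 - l) * (μ - ν) ^ 2 / (2 * s ^ 2) := by
  simp_rw [gaussianPdf_rpow_mul_rpow μ ν hs]
  rw [integral_const_mul, integral_gaussianPdf _ hs, mul_one, Real.log_exp, neg_neg]

/-- The Chernoff information between two Gaussian densities of equal variance. -/
theorem isGreatest_chernoff_gaussianPdf (μ ν : ℝ) {s : ℝ} (hs : 0 < s) :
    IsGreatest {x : ℝ | ∃ l ∈ Set.Icc (0 : ℝ) 1,
        x = -Real.log (∫ y, gaussianPdf μ s y ^ l * gaussianPdf ν s y ^ (1 - l))}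
      ((μ - ν) ^ 2 / (8 * s ^ 2)) := by
  simp_rw [neg_log_integral_gaussianPdf_rpow μ ν hs]
  constructor
  · exact ⟨1 / 2, by norm_num, by ring⟩
  · rintro x ⟨l, -, rfl⟩
    have h : (μ - ν) ^ 2 / (8 * s ^ 2) - l * (1 - l) * (μ - ν) ^ 2 / (2 * s ^ 2) =
        ((2 * l - 1) * (μ - ν) / s) ^ 2 / 8 := by
      field_simp
      ring
    linarith [sq_nonneg ((2 * l - 1) * (μ - ν) / s)]

theorem mixed_observation_two_gaussians
    (A B σ a₁ a₂ : ℝ) (hAB : A ≠ B) (hσ : 0 < σ) (ha : (a₁, a₂) ≠ (0, 0)) :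
    IsGreatest
      {x : ℝ | ∃ lam ∈ Set.Icc (0 : ℝ) 1,
        x = -Real.log (∫ y : ℝ,
          (gaussianPdf (a₁ * A + a₂ * B) (Real.sqrt ((a₁ ^ 2 + a₂ ^ 2) * σ ^ 2)) y) ^ lam *
          (gaussianPdf (a₁ * B + a₂ * A) (Real.sqrt ((a₁ ^ 2 + a₂ ^ 2) * σ ^ 2)) y) ^ (1 - lam))}
      ((a₁ - a₂) ^ 2 * (A - B) ^ 2 / (8 * (a₁ ^ 2 + a₂ ^ 2) * σ ^ 2)) ∧
    (a₁ - a₂) ^ 2 * (A - B) ^ 2 / (8 * (a₁ ^ 2 + a₂ ^ 2) * σ ^ 2) ≤ (A - B) ^ 2 / (4 * σ ^ 2) ∧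
    ((a₁ - a₂) ^ 2 * (A - B) ^ 2 / (8 * (a₁ ^ 2 + a₂ ^ 2) * σ ^ 2) = (A - B) ^ 2 / (4 * σ ^ 2)
      ↔ a₁ = -a₂) := by
  have hq : 0 < a₁ ^ 2 + a₂ ^ 2 := by
    by_contra! h
    apply ha
    rw [Prod.mk.injEq]
    constructor <;> nlinarith [sq_nonneg a₁, sq_nonneg a₂]
  have hd : A - B ≠ 0 := sub_ne_zero.mpr hAB
  have hdiff : (A - B) ^ 2 / (4 * σ ^ 2) -
      (a₁ - a₂) ^ 2 * (A - B) ^ 2 / (8 * (a₁ ^ 2 + a₂ ^ 2) * σ ^ 2) =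
      (a₁ + a₂) ^ 2 * ((A - B) ^ 2 / (8 * (a₁ ^ 2 + a₂ ^ 2) * σ ^ 2)) := by
    field_simp
    ring
  have hpos : 0 < (A - B) ^ 2 / (8 * (a₁ ^ 2 + a₂ ^ 2) * σ ^ 2) := by positivity
  refine ⟨?_, ?_, ?_⟩
  · have hv : 0 < (a₁ ^ 2 + a₂ ^ 2) * σ ^ 2 := by positivity
    convert isGreatest_chernoff_gaussianPdf (a₁ * A + a₂ * B) (a₁ * B + a₂ * A)
      (Real.sqrt_pos.mpr hv) using 1
    rw [Real.sq_sqrt hv.le]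
    ring
  · rw [← sub_nonneg, hdiff]
    positivity
  · rw [eq_comm, ← sub_eq_zero, hdiff, mul_eq_zero, or_iff_left hpos.ne', sq_eq_zero_iff,
      add_eq_zero_iff_eq_neg]
end

section
/- Let B > 1 and define α* = (B·log B − (B−1)) / ((B−1)·log B). Then α* ∈ (0,1), and for all α ∈ [0,1], (1/2)·log( (α + (1−α)B) / B^(1−α) ) ≤ (1/2)·( −1 + (B/(B−1))·log B + log( (B−1)/(B·log B) ) ), with equality when α = α*. In other words, α* maximizes α ↦ (1/2)·log((α + (1−α)B)/B^(1−α)) over [0,1], and the maximum value is (1/2)·{−1 + (B/(B−1))·log B + log((B−1)/(B·log B))}. -/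
open Real

/-- The Chernoff objective in terms of the mixed variance `m = α + (1 - α) * B`, using
`1 - α = (m - 1) / (B - 1)`. -/
lemma log_mix_div_rpow {B α : ℝ} (hB : 1 < B) (hm : 0 < α + (1 - α) * B) :
    log ((α + (1 - α) * B) / B ^ (1 - α)) =
      log (α + (1 - α) * B) - (α + (1 - α) * B - 1) / (B - 1) * log B := by
  have hB0 : 0 < B := by linarith
  have hB1 : B - 1 ≠ 0 := by linarith
  rw [log_div hm.ne' (rpow_pos_of_pos hB0 _).ne', log_rpow hB0]
  congr 2
  field_simp
  ring

lemma log_sub_one_div_mul_log {B : ℝ} (hB : 1 < B) :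
    log ((B - 1) / (B * log B)) = log ((B - 1) / log B) - log B := by
  have hB0 : B ≠ 0 := by linarith
  have hB1 : B - 1 ≠ 0 := by linarith
  have hL : log B ≠ 0 := (log_pos hB).ne'
  rw [← log_div (div_ne_zero hB1 hL) hB0, div_div, mul_comm B]

theorem chernoff_objective_optimal_alpha
    (B : ℝ) (hB : 1 < B) :
    (B * Real.log B - (B - 1)) / ((B - 1) * Real.log B) ∈ Set.Ioo (0 : ℝ) 1 ∧
    (∀ α ∈ Set.Icc (0 : ℝ) 1,
      (1 / 2) * Real.log ((α + (1 - α) * B) / B ^ (1 - α))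
        ≤ (1 / 2) * (-1 + (B / (B - 1)) * Real.log B + Real.log ((B - 1) / (B * Real.log B)))) ∧
    (1 / 2) * Real.log
        ((((B * Real.log B - (B - 1)) / ((B - 1) * Real.log B))
            + (1 - (B * Real.log B - (B - 1)) / ((B - 1) * Real.log B)) * B)
          / B ^ (1 - (B * Real.log B - (B - 1)) / ((B - 1) * Real.log B)))
      = (1 / 2) * (-1 + (B / (B - 1)) * Real.log B + Real.log ((B - 1) / (B * Real.log B))) := by
  have hB0 : 0 < B := by linarith
  have hB1 : 0 < B - 1 := by linarith
  have hL : 0 < log B := log_pos hB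
  have hLlt : log B < B - 1 := log_lt_sub_one_of_pos hB0 hB.ne'
  have hltBL : B - 1 < B * log B := by
    have h := log_lt_sub_one_of_pos (inv_pos.2 hB0) (inv_ne_one.2 hB.ne')
    rw [log_inv] at h
    have h' := mul_lt_mul_of_pos_left h hB0
    rw [mul_sub, mul_inv_cancel₀ hB0.ne'] at h'
    linarith
  refine ⟨⟨div_pos (by linarith) (by positivity), ?_⟩, ?_, ?_⟩
  · rw [div_lt_one (by positivity)]
    linarith
  · rintro α ⟨h0, h1⟩
    have hm : 0 < α + (1 - α) * B := by nlinarith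
    rw [log_mix_div_rpow hB hm, log_sub_one_div_mul_log hB]
    generalize α + (1 - α) * B = m at hm ⊢
    have hmax : 0 < (B - 1) / log B := by positivity
    have h := log_le_sub_one_of_pos (div_pos hm hmax)
    rw [log_div hm.ne' hmax.ne'] at h
    have e : m / ((B - 1) / log B) - 1 - (m - 1) / (B - 1) * log B =
        -1 + B / (B - 1) * log B - log B := by
      field_simp
      ring
    linarith
  · have hm : (B * log B - (B - 1)) / ((B - 1) * log B)
        + (1 - (B * log B - (B - 1)) / ((B - 1) * log B)) * B = (B - 1) / log B := by
      field_simp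
      ring
    rw [log_mix_div_rpow hB (by rw [hm]; positivity), hm, log_sub_one_div_mul_log hB]
    have e : ((B - 1) / log B - 1) / (B - 1) * log B =
        1 - B / (B - 1) * log B + log B := by
      field_simp
      ring
    linarith
end

section
/- Let σ₁ > 0 and σ₂ > 0, and for λ ∈ [0,1] define I(σ_a, σ_b, λ) = ∫_ℝ φ_{0,σ_a²}(y)^λ · φ_{0,σ_b²}(y)^(1−λ) dy. Then for every λ ∈ [0,1], −(1/2)·log I(σ₁, σ₂, λ) − (1/2)·log I(σ₂, σ₁, λ) ≤ (1/2)·log( (σ₁² + σ₂²) / (2σ₁σ₂) ), with equality when λ = 1/2. Equivalently, with B = max(σ₁², σ₂²)/min(σ₁², σ₂²), the optimal value of this symmetric average equals (1/2)·log((B+1)/(2·B^(1/2))), attained at λ = 1/2. -/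
open MeasureTheory Real

/-- The Chernoff integral `∫ φ_{0,σₐ²}(y)^λ φ_{0,σᵦ²}(y)^(1-λ) dy`. -/
noncomputable def chernoffIntegral (σa σb lam : ℝ) : ℝ :=
  ∫ y : ℝ, (gaussianPdf 0 σa y) ^ lam * (gaussianPdf 0 σb y) ^ (1 - lam)

/-- The mixed variance `lam * σb ^ 2 + (1 - lam) * σa ^ 2` is positive. -/
theorem mixedVariance_pos {σa σb lam : ℝ} (ha : 0 < σa) (hb : 0 < σb)
    (hlam : lam ∈ Set.Icc (0 : ℝ) 1) : 0 < lam * σb ^ 2 + (1 - lam) * σa ^ 2 := by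
  obtain ⟨h0, h1⟩ := hlam
  rcases h0.eq_or_lt with rfl | h0
  · simpa using pow_pos ha 2
  · exact add_pos_of_pos_of_nonneg (by positivity) (mul_nonneg (by linarith) (by positivity))

theorem log_chernoffIntegral {σa σb lam : ℝ} (ha : 0 < σa) (hb : 0 < σb)
    (hlam : lam ∈ Set.Icc (0 : ℝ) 1) :
    Real.log (chernoffIntegral σa σb lam) = (1 - lam) * Real.log σa + lam * Real.log σb
      - 1 / 2 * Real.log (lam * σb ^ 2 + (1 - lam) * σa ^ 2) := by
  have hP := mixedVariance_pos ha hb hlam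
  have hsqrt : ∀ σ : ℝ, 0 < σ → 0 < √(2 * π * σ ^ 2) := fun σ hσ => by positivity
  have hlog : ∀ σ : ℝ, 0 < σ →
      Real.log √(2 * π * σ ^ 2) = 1 / 2 * Real.log (2 * π) + Real.log σ := fun σ hσ => by
    rw [Real.log_sqrt (by positivity), Real.log_mul (by positivity) (by positivity),
      Real.log_pow]
    push_cast
    ring
  have hCa := inv_pos.2 (hsqrt σa ha)
  have hCb := inv_pos.2 (hsqrt σb hb)
  have hpt : ∀ y : ℝ, gaussianPdf 0 σa y ^ lam * gaussianPdf 0 σb y ^ (1 - lam)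
      = (√(2 * π * σa ^ 2))⁻¹ ^ lam * (√(2 * π * σb ^ 2))⁻¹ ^ (1 - lam)
        * Real.exp (-((lam * σb ^ 2 + (1 - lam) * σa ^ 2) / (2 * σa ^ 2 * σb ^ 2)) * y ^ 2) := by
    intro y
    have hexp : -((lam * σb ^ 2 + (1 - lam) * σa ^ 2) / (2 * σa ^ 2 * σb ^ 2)) * y ^ 2
        = -(y - 0) ^ 2 / (2 * σa ^ 2) * lam + -(y - 0) ^ 2 / (2 * σb ^ 2) * (1 - lam) := by
      field_simp
      ring
    rw [gaussianPdf, gaussianPdf, Real.mul_rpow hCa.le (Real.exp_pos _).le,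
      Real.mul_rpow hCb.le (Real.exp_pos _).le, ← Real.exp_mul, ← Real.exp_mul, hexp,
      Real.exp_add]
    ring
  have hquot : π / ((lam * σb ^ 2 + (1 - lam) * σa ^ 2) / (2 * σa ^ 2 * σb ^ 2))
      = 2 * π * (σa ^ 2 * σb ^ 2) / (lam * σb ^ 2 + (1 - lam) * σa ^ 2) := by
    field_simp
  rw [chernoffIntegral, integral_congr_ae (ae_of_all _ hpt), integral_const_mul,
    integral_gaussian, hquot, Real.log_mul (by positivity) (by positivity),
    Real.log_mul (by positivity) (by positivity), Real.log_rpow hCa, Real.log_rpow hCb,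
    Real.log_inv, Real.log_inv, hlog σa ha, hlog σb hb, Real.log_sqrt (by positivity),
    Real.log_div (by positivity) hP.ne',
    Real.log_mul (x := 2 * π) (by positivity) (by positivity),
    Real.log_mul (x := σa ^ 2) (by positivity) (by positivity), Real.log_pow, Real.log_pow]
  push_cast
  ring

/-- The ratio of arithmetic to geometric mean of `x ^ 2`, `y ^ 2` in terms of `x ^ 2 / y ^ 2`. -/
theorem sq_add_sq_div_two_mul_eq {x y : ℝ} (hx : 0 < x) (hy : 0 < y) :
    (x ^ 2 + y ^ 2) / (2 * x * y)
      = (x ^ 2 / y ^ 2 + 1) / (2 * (x ^ 2 / y ^ 2) ^ ((1 : ℝ) / 2)) := by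
  rw [← Real.sqrt_eq_rpow, ← div_pow, Real.sqrt_sq (by positivity)]
  field_simp

theorem separate_observation_symmetric_chernoff
    (σ₁ σ₂ : ℝ) (hσ₁ : 0 < σ₁) (hσ₂ : 0 < σ₂) :
    (∀ lam ∈ Set.Icc (0 : ℝ) 1,
      -(1 / 2) * Real.log (chernoffIntegral σ₁ σ₂ lam)
          - (1 / 2) * Real.log (chernoffIntegral σ₂ σ₁ lam)
        ≤ (1 / 2) * Real.log ((σ₁ ^ 2 + σ₂ ^ 2) / (2 * σ₁ * σ₂))) ∧
    (-(1 / 2) * Real.log (chernoffIntegral σ₁ σ₂ (1 / 2))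
          - (1 / 2) * Real.log (chernoffIntegral σ₂ σ₁ (1 / 2))
        = (1 / 2) * Real.log ((σ₁ ^ 2 + σ₂ ^ 2) / (2 * σ₁ * σ₂))) ∧
    (1 / 2) * Real.log ((σ₁ ^ 2 + σ₂ ^ 2) / (2 * σ₁ * σ₂))
      = (1 / 2) * Real.log
          ((max (σ₁ ^ 2) (σ₂ ^ 2) / min (σ₁ ^ 2) (σ₂ ^ 2) + 1)
            / (2 * (max (σ₁ ^ 2) (σ₂ ^ 2) / min (σ₁ ^ 2) (σ₂ ^ 2)) ^ ((1 : ℝ) / 2))) := by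
  have hrhs : Real.log ((σ₁ ^ 2 + σ₂ ^ 2) / (2 * σ₁ * σ₂))
      = Real.log ((σ₁ ^ 2 + σ₂ ^ 2) / 2) - Real.log σ₁ - Real.log σ₂ := by
    rw [mul_assoc, ← div_div, Real.log_div (by positivity) (by positivity),
      Real.log_mul hσ₁.ne' hσ₂.ne']
    ring
  refine ⟨fun lam hlam => ?_, ?_, ?_⟩
  · have hP := mixedVariance_pos hσ₁ hσ₂ hlam
    have hQ := mixedVariance_pos hσ₂ hσ₁ hlam
    have hle : Real.log (lam * σ₂ ^ 2 + (1 - lam) * σ₁ ^ 2)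
        + Real.log (lam * σ₁ ^ 2 + (1 - lam) * σ₂ ^ 2)
          ≤ 2 * Real.log ((σ₁ ^ 2 + σ₂ ^ 2) / 2) := by
      rw [← Real.log_mul hP.ne' hQ.ne', two_mul,
        ← Real.log_mul (by positivity) (by positivity)]
      apply Real.log_le_log (mul_pos hP hQ)
      nlinarith [sq_nonneg ((2 * lam - 1) * (σ₁ ^ 2 - σ₂ ^ 2))]
    rw [log_chernoffIntegral hσ₁ hσ₂ hlam, log_chernoffIntegral hσ₂ hσ₁ hlam, hrhs]
    linarith
  · have hhalf : (1 / 2 : ℝ) ∈ Set.Icc (0 : ℝ) 1 := by norm_num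
    rw [log_chernoffIntegral hσ₁ hσ₂ hhalf, log_chernoffIntegral hσ₂ hσ₁ hhalf, hrhs,
      show 1 / 2 * σ₂ ^ 2 + (1 - 1 / 2) * σ₁ ^ 2 = (σ₁ ^ 2 + σ₂ ^ 2) / 2 by ring,
      show 1 / 2 * σ₁ ^ 2 + (1 - 1 / 2) * σ₂ ^ 2 = (σ₁ ^ 2 + σ₂ ^ 2) / 2 by ring]
    ring
  · rcases le_total σ₁ σ₂ with h | h
    · have hsq : σ₁ ^ 2 ≤ σ₂ ^ 2 := by gcongr
      rw [max_eq_right hsq, min_eq_left hsq, ← sq_add_sq_div_two_mul_eq hσ₂ hσ₁,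
        add_comm, mul_right_comm]
    · have hsq : σ₂ ^ 2 ≤ σ₁ ^ 2 := by gcongr
      rw [max_eq_left hsq, min_eq_right hsq, ← sq_add_sq_div_two_mul_eq hσ₁ hσ₂]
end
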